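/- The θ-Gibbs conditional density integrates to one: Fix an integer N ≥ 2, a real θ > 0, and a point (y^N_1, …, y^N_N) in the open Weyl chamber W^N. Then the integral, over all arrays (y^k_i)_{1≤i≤k≤N−1} satisfying the strict interlacing conditions y^{k}_{i−1} < y^{k−1}_{i−1} and y^{k-1}_{i-1} < y^k_i < y^{k-1}_i for 2 ≤ k ≤ N (with the given top row y^N), of the function ∏_{k=2}^N [ (Γ(kθ)/Γ(θ)^k) · ∏_{1≤i<m≤k−1} (y^{k−1}_m − y^{k−1}_i) · ∏_{i=1}^{k−1} ∏_{j=1}^k |y^k_j − y^{k−1}_i|^{θ−1} · ∏_{1≤j<n≤k} (y^k_n − y^k_j)^{1−2θ} ] with respect to Lebesgue measure on the N(N−1)/2 free coordinates, equals 1. -/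

import Mathlib

open MeasureTheory Real

/-- Glue an array of levels `1,…,n` (level `k+1` has `k+1` particles, for `k : Fin n`)
with a prescribed top row of `n+1` particles, producing a full triangular array
with levels `1,…,n+1`. -/
def glueGT {n : ℕ} (y : ∀ k : Fin n, (Fin (k.1 + 1) → ℝ)) (top : Fin (n + 1) → ℝ) :
    ∀ k : Fin (n + 1), (Fin (k.1 + 1) → ℝ) :=
  fun k i =>
    if h : (k : ℕ) < n then y ⟨k.1, h⟩ ⟨i.1, i.2⟩
    else top ⟨i.1, lt_of_lt_of_le i.2 (Nat.succ_le_succ (Nat.lt_succ_iff.mp k.2))⟩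

/-- A triangular array `(Y^k_i)` is strictly interlacing if
`Y^{k+1}_{i} < Y^k_i < Y^{k+1}_{i+1}` (rows listed in increasing order within each level). -/
def StrictInterlacing {n : ℕ} (Y : ∀ k : Fin (n + 1), (Fin (k.1 + 1) → ℝ)) : Prop :=
  ∀ (k : Fin n) (i : Fin (k.1 + 1)),
    Y k.succ ⟨i.1, Nat.lt_succ_of_lt i.2⟩ < Y k.castSucc i ∧
      Y k.castSucc i < Y k.succ ⟨i.1 + 1, Nat.succ_lt_succ i.2⟩

/-- The Vandermonde product `∏_{i<m} (x_m - x_i)`. -/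
def vdm {n : ℕ} (x : Fin n → ℝ) : ℝ := ∏ m, ∏ i ∈ Finset.Iio m, (x m - x i)

/-- The row `x` strictly interlaces with the row `a` above it. -/
def Interlaces {m : ℕ} (a : Fin (m + 1) → ℝ) (x : Fin m → ℝ) : Prop :=
  ∀ i : Fin m, a i.castSucc < x i ∧ x i < a i.succ

lemma vdm_pos {n : ℕ} {x : Fin n → ℝ} (hx : StrictMono x) : 0 < vdm x :=
  Finset.prod_pos fun _ _ => Finset.prod_pos fun _ hi => sub_pos.2 (hx (Finset.mem_Iio.1 hi))

lemma prod_Ioi_eq_prod_Iio {n : ℕ} (f : Fin n → Fin n → ℝ) :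
    ∏ i, ∏ j ∈ Finset.Ioi i, f i j = ∏ j, ∏ i ∈ Finset.Iio j, f i j :=
  Finset.prod_comm' (by simp)

lemma vdm_eq_prod_Ioi {n : ℕ} (x : Fin n → ℝ) :
    vdm x = ∏ i, ∏ j ∈ Finset.Ioi i, (x j - x i) :=
  (prod_Ioi_eq_prod_Iio fun i j => x j - x i).symm

lemma det_vandermonde_eq_vdm {n : ℕ} (x : Fin n → ℝ) : (Matrix.vandermonde x).det = vdm x := by
  rw [Matrix.det_vandermonde, vdm_eq_prod_Ioi]

lemma prod_erase_abs_sub {n : ℕ} {x : Fin n → ℝ} (hx : StrictMono x) :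
    ∏ j, ∏ l ∈ Finset.univ.erase j, |x j - x l| = vdm x ^ 2 := by
  have h (j : Fin n) : ∏ l ∈ Finset.univ.erase j, |x j - x l| =
      (∏ l ∈ Finset.Iio j, |x j - x l|) * ∏ l ∈ Finset.Ioi j, |x j - x l| := by
    rw [← Finset.prod_union (Finset.disjoint_left.2 fun l h1 h2 => by
      simp only [Finset.mem_Iio, Finset.mem_Ioi] at h1 h2; exact lt_asymm h1 h2)]
    congr 1
    ext l
    simp
  simp_rw [h]
  rw [Finset.prod_mul_distrib, prod_Ioi_eq_prod_Iio (fun i j => |x i - x j|), sq]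
  congr 1
  · exact Finset.prod_congr rfl fun j _ => Finset.prod_congr rfl fun l hl =>
      abs_of_pos (sub_pos.2 (hx (Finset.mem_Iio.1 hl)))
  · refine Finset.prod_congr rfl fun j _ => Finset.prod_congr rfl fun l hl => ?_
    rw [abs_sub_comm]
    exact abs_of_pos (sub_pos.2 (hx (Finset.mem_Iio.1 hl)))

lemma prod_succAbove_eq_prod_erase {m : ℕ} (j : Fin (m + 1)) (g : Fin (m + 1) → ℝ) :
    ∏ i, g (j.succAbove i) = ∏ l ∈ Finset.univ.erase j, g l := by
  rw [← Finset.compl_singleton, ← Fin.image_succAbove_univ,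
    Finset.prod_image (fun _ _ _ _ h => Fin.succAbove_right_injective h)]

lemma eval_eq_vandermonde_mul {n : ℕ} (v : Fin n → ℝ) (q : Fin n → Polynomial ℝ)
    (hq : ∀ k, (q k).natDegree < n) :
    Matrix.of (fun j k => (q k).eval (v j)) =
      Matrix.vandermonde v * Matrix.of (fun (d k : Fin n) => (q k).coeff d) := by
  ext j k
  simp only [Matrix.of_apply, Matrix.mul_apply, Matrix.vandermonde_apply]
  rw [Polynomial.eval_eq_sum_range' (hq k),
    ← Fin.sum_univ_eq_sum_range (fun d => (q k).coeff d * v j ^ d)]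
  exact Finset.sum_congr rfl fun _ _ => mul_comm _ _

lemma Interlaces.strictMono {m : ℕ} {a : Fin (m + 1) → ℝ} {x : Fin m → ℝ} (ha : StrictMono a)
    (h : Interlaces a x) : StrictMono x := fun i j hij =>
  ((h i).2.trans_le (ha.monotone (Fin.succ_le_castSucc_iff.2 hij))).trans (h j).1

lemma Interlaces.zero_lt {m : ℕ} {a : Fin (m + 1) → ℝ} {x : Fin m → ℝ} (ha : StrictMono a)
    (h : Interlaces a x) (i : Fin m) : a 0 < x i :=
  (ha.monotone (Fin.zero_le _)).trans_lt (h i).1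

/-- The matrix of values at `a` of `∏ (X - x_i)` and of the products omitting one factor. -/
def nodalMatrix {m : ℕ} (a : Fin (m + 1) → ℝ) (x : Fin m → ℝ) :
    Matrix (Fin (m + 1)) (Fin (m + 1)) ℝ :=
  Matrix.of fun j => Fin.cons (∏ i, (a j - x i)) fun i => ∏ l ∈ Finset.univ.erase i, (a j - x l)

lemma exists_det_nodalMatrix {m : ℕ} (x : Fin m → ℝ) :
    ∃ c : ℝ, ∀ v : Fin (m + 1) → ℝ, (nodalMatrix v x).det = vdm v * c := by
  let q : Fin (m + 1) → Polynomial ℝ :=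
    Fin.cons (Lagrange.nodal Finset.univ x) fun i => Lagrange.nodal (Finset.univ.erase i) x
  have hq : ∀ k, (q k).natDegree < m + 1 := by
    refine Fin.cases ?_ fun i => ?_
    · simp [q, Lagrange.natDegree_nodal]
    · simp only [q, Fin.cons_succ, Lagrange.natDegree_nodal]
      exact (Finset.card_le_univ _).trans_lt (by simp)
  refine ⟨(Matrix.of fun (d k : Fin (m + 1)) => (q k).coeff d).det, fun v => ?_⟩
  rw [← det_vandermonde_eq_vdm, ← Matrix.det_mul, ← eval_eq_vandermonde_mul v q hq]
  congr 1
  ext j k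
  refine Fin.cases ?_ (fun i => ?_) k <;> simp [nodalMatrix, q, Lagrange.eval_nodal]

lemma vdm_cons {m : ℕ} (y : ℝ) (x : Fin m → ℝ) :
    vdm (Fin.cons y x : Fin (m + 1) → ℝ) = (∏ i, (x i - y)) * vdm x := by
  rw [vdm_eq_prod_Ioi, vdm_eq_prod_Ioi, Fin.prod_univ_succ]
  simp [Fin.prod_Ioi_succ]

lemma abs_det_nodalMatrix {m : ℕ} {a : Fin (m + 1) → ℝ} {x : Fin m → ℝ} (ha : StrictMono a)
    (h : Interlaces a x) : |(nodalMatrix a x).det| = vdm a * vdm x := by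
  obtain ⟨c, hc⟩ := exists_det_nodalMatrix x
  have hx := h.strictMono ha
  have hxp := vdm_pos hx
  have hP : 0 < ∏ i, (x i - a 0) := Finset.prod_pos fun i _ => sub_pos.2 (h.zero_lt ha i)
  have key := hc (Fin.cons (a 0) x)
  rw [vdm_cons, Matrix.det_of_isUpperTriangular, Fin.prod_univ_succ] at key
  · have key' := congrArg abs key
    simp only [nodalMatrix, Matrix.of_apply, Fin.cons_zero, Fin.cons_succ, abs_mul,
      Finset.abs_prod] at key'
    rw [prod_erase_abs_sub hx, ← Finset.abs_prod, ← Finset.abs_prod, abs_of_pos hP,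
      abs_of_pos hxp, Finset.abs_prod, Finset.prod_congr rfl (fun i _ => abs_sub_comm (a 0) (x i)),
      ← Finset.abs_prod, abs_of_pos hP] at key'
    have : |c| = vdm x := by
      have h2 : ((∏ i, (x i - a 0)) * vdm x) * |c| = ((∏ i, (x i - a 0)) * vdm x) * vdm x := by
        rw [← key']; ring
      exact mul_left_cancel₀ (mul_pos hP hxp).ne' h2
    rw [hc, abs_mul, this, abs_of_pos (vdm_pos ha)]
  · intro i
    refine Fin.cases (fun j hj => absurd hj (by simp)) (fun i j hj => ?_) i
    refine Fin.cases (fun _ => ?_) (fun j hj => ?_) j hj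
    · simp only [nodalMatrix, Matrix.of_apply, Fin.cons_zero, Fin.cons_succ]
      exact Finset.prod_eq_zero (Finset.mem_univ i) (sub_self _)
    · simp only [nodalMatrix, Matrix.of_apply, Fin.cons_succ]
      exact Finset.prod_eq_zero
        (Finset.mem_erase.2 ⟨fun e => by simp [e] at hj, Finset.mem_univ i⟩) (sub_self _)

/-- The Dixon–Anderson map `(t, x) ↦ (t ∏_i (a_j - x_i) / ∏_{l ≠ j} (a_j - a_l))_j`. -/
noncomputable def residueMap {m : ℕ} (a p : Fin (m + 1) → ℝ) (j : Fin (m + 1)) : ℝ :=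
  p 0 * ∏ i : Fin m, ((a j - p i.succ) / (a j - a (j.succAbove i)))

lemma sub_div_sub_succAbove_pos {m : ℕ} {a : Fin (m + 1) → ℝ} {x : Fin m → ℝ} (ha : StrictMono a)
    (h : Interlaces a x) (j : Fin (m + 1)) (i : Fin m) :
    0 < (a j - x i) / (a j - a (j.succAbove i)) := by
  rcases lt_or_ge i.castSucc j with hij | hij
  · rw [Fin.succAbove_of_castSucc_lt _ _ hij]
    exact div_pos (sub_pos.2 ((h i).2.trans_le (ha.monotone (Fin.castSucc_lt_iff_succ_le.1 hij))))
      (sub_pos.2 (ha hij))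
  · rw [Fin.succAbove_of_le_castSucc _ _ hij]
    exact div_pos_of_neg_of_neg (sub_neg.2 ((ha.monotone hij).trans_lt (h i).1))
      (sub_neg.2 (ha (hij.trans_lt Fin.castSucc_lt_succ)))

lemma sub_succAbove_ne_zero {m : ℕ} {a : Fin (m + 1) → ℝ} (ha : StrictMono a)
    (j : Fin (m + 1)) (i : Fin m) : a j - a (j.succAbove i) ≠ 0 :=
  sub_ne_zero.2 fun e => Fin.succAbove_ne j i (ha.injective e).symm

lemma prod_sub_succAbove_ne_zero {m : ℕ} {a : Fin (m + 1) → ℝ} (ha : StrictMono a)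
    (j : Fin (m + 1)) : ∏ i, (a j - a (j.succAbove i)) ≠ 0 :=
  Finset.prod_ne_zero_iff.2 fun i _ => sub_succAbove_ne_zero ha j i

lemma prod_sub_succAbove_mul_neg {m : ℕ} {a : Fin (m + 1) → ℝ} (ha : StrictMono a) (i : Fin m) :
    (∏ l, (a i.castSucc - a (i.castSucc.succAbove l))) *
      ∏ l, (a i.succ - a (i.succ.succAbove l)) < 0 := by
  rw [← Finset.prod_mul_distrib, ← Finset.mul_prod_erase _ _ (Finset.mem_univ i)]
  refine mul_neg_of_neg_of_pos ?_ (Finset.prod_pos fun l hl => ?_)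
  · rw [Fin.succAbove_castSucc_self, Fin.succAbove_succ_self]
    have : a i.castSucc < a i.succ := ha Fin.castSucc_lt_succ
    nlinarith
  · rcases lt_or_gt_of_ne (Finset.ne_of_mem_erase hl) with hl | hl
    · rw [Fin.succAbove_of_castSucc_lt i.castSucc l (by simpa using hl),
        Fin.succAbove_of_castSucc_lt i.succ l (by grind)]
      exact mul_pos (sub_pos.2 (ha (by simpa using hl)))
        (sub_pos.2 (ha (by grind)))
    · rw [Fin.succAbove_of_le_castSucc i.castSucc l (by simpa using hl.le),
        Fin.succAbove_of_le_castSucc i.succ l (by grind)]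
      exact mul_pos_of_neg_of_neg (sub_neg.2 (ha (by grind)))
        (sub_neg.2 (ha (by simpa using hl)))

lemma residueMap_mul_prod {m : ℕ} {a : Fin (m + 1) → ℝ} (ha : StrictMono a)
    (p : Fin (m + 1) → ℝ) (j : Fin (m + 1)) :
    residueMap a p j * ∏ i, (a j - a (j.succAbove i)) =
      (Polynomial.C (p 0) * Lagrange.nodal Finset.univ (fun i : Fin m => p i.succ)).eval (a j) := by
  rw [residueMap, Finset.prod_div_distrib, mul_assoc,
    div_mul_cancel₀ _ (prod_sub_succAbove_ne_zero ha j)]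
  simp [Lagrange.eval_nodal]

lemma degree_C_mul_nodal_lt {m : ℕ} (t : ℝ) (x : Fin m → ℝ) :
    (Polynomial.C t * Lagrange.nodal Finset.univ x).degree <
      (Finset.univ : Finset (Fin (m + 1))).card := by
  rw [← Polynomial.smul_eq_C_mul]
  refine (Polynomial.degree_smul_le _ _).trans_lt ?_
  rw [Lagrange.degree_nodal]
  simp only [Finset.card_univ, Fintype.card_fin]
  exact_mod_cast Nat.lt_succ_self m

lemma coeff_C_mul_nodal {m : ℕ} (t : ℝ) (x : Fin m → ℝ) :
    (Polynomial.C t * Lagrange.nodal Finset.univ x).coeff m = t := by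
  have h := (Lagrange.nodal_monic (s := Finset.univ) (v := x)).coeff_natDegree
  rw [Lagrange.natDegree_nodal, Finset.card_univ, Fintype.card_fin] at h
  rw [Polynomial.coeff_C_mul, h, mul_one]

lemma sum_residueMap {m : ℕ} {a : Fin (m + 1) → ℝ} (ha : StrictMono a) (p : Fin (m + 1) → ℝ) :
    ∑ j, residueMap a p j = p 0 := by
  have h := Lagrange.coeff_eq_sum (s := Finset.univ) (v := a) ha.injective.injOn
    (degree_C_mul_nodal_lt (p 0) fun i : Fin m => p i.succ)
  rw [Finset.card_univ, Fintype.card_fin, Nat.add_sub_cancel, coeff_C_mul_nodal] at h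
  rw [h]
  refine Finset.sum_congr rfl fun j _ => ?_
  rw [← residueMap_mul_prod ha, ← prod_succAbove_eq_prod_erase j (fun l => a j - a l),
    mul_div_cancel_right₀ _ (prod_sub_succAbove_ne_zero ha j)]

/-- The source of the Dixon–Anderson change of variables. -/
def scaledInterlacing {m : ℕ} (a : Fin (m + 1) → ℝ) : Set (Fin (m + 1) → ℝ) :=
  {p | 0 < p 0 ∧ Interlaces a fun i => p i.succ}

lemma residueMap_pos {m : ℕ} {a p : Fin (m + 1) → ℝ} (ha : StrictMono a)
    (hp : p ∈ scaledInterlacing a) (j : Fin (m + 1)) : 0 < residueMap a p j :=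
  mul_pos hp.1 (Finset.prod_pos fun i _ => sub_div_sub_succAbove_pos ha hp.2 j i)

lemma residueMap_injOn {m : ℕ} {a : Fin (m + 1) → ℝ} (ha : StrictMono a) :
    Set.InjOn (residueMap a) (scaledInterlacing a) := by
  intro p hp q hq hpq
  have hpoly := Polynomial.eq_of_degrees_lt_of_eval_index_eq Finset.univ (v := a)
    ha.injective.injOn (degree_C_mul_nodal_lt (p 0) fun i : Fin m => p i.succ)
    (degree_C_mul_nodal_lt (q 0) fun i : Fin m => q i.succ) fun j _ => by
      rw [← residueMap_mul_prod ha, ← residueMap_mul_prod ha, hpq]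
  funext k
  refine Fin.cases ?_ (fun i => ?_) k
  · have := congrArg (fun P => P.coeff m) hpoly
    simpa only [coeff_C_mul_nodal] using this
  · have h := congrArg (Polynomial.eval (p i.succ)) hpoly
    simp only [Polynomial.eval_mul, Polynomial.eval_C, Lagrange.eval_nodal] at h
    rw [Finset.prod_eq_zero (Finset.mem_univ i) (sub_self _), mul_zero, eq_comm,
      mul_eq_zero, or_iff_right hq.1.ne', Finset.prod_eq_zero_iff] at h
    obtain ⟨l, -, hl⟩ := h
    have hl := sub_eq_zero.1 hl
    have h1 := hp.2 i
    have h2 := hq.2 l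
    simp only at h1 h2
    rw [← hl] at h2
    have h3 := ha.lt_iff_lt.1 (h1.1.trans h2.2)
    have h4 := ha.lt_iff_lt.1 (h2.1.trans h1.2)
    have : i = l := by
      ext
      simp only [Fin.lt_def, Fin.val_castSucc, Fin.val_succ] at h3 h4
      omega
    rw [hl, this]

lemma exists_root_of_eval_mul_neg {P : Polynomial ℝ} {u v : ℝ} (huv : u < v)
    (h : P.eval u * P.eval v < 0) : ∃ z, (u < z ∧ z < v) ∧ P.eval z = 0 := by
  have hc : ContinuousOn (fun z => P.eval z) (Set.Icc u v) := P.continuous.continuousOn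
  rcases mul_neg_iff.1 h with ⟨h1, h2⟩ | ⟨h1, h2⟩
  · obtain ⟨z, hz, hz0⟩ := intermediate_value_Ioo' huv.le hc ⟨h2, h1⟩
    exact ⟨z, hz, hz0⟩
  · obtain ⟨z, hz, hz0⟩ := intermediate_value_Ioo huv.le hc ⟨h1, h2⟩
    exact ⟨z, hz, hz0⟩

lemma exists_residueMap_eq {m : ℕ} {a : Fin (m + 1) → ℝ} (ha : StrictMono a)
    {r : Fin (m + 1) → ℝ} (hr : ∀ j, 0 < r j) : ∃ p ∈ scaledInterlacing a, residueMap a p = r := by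
  set D : Fin (m + 1) → ℝ := fun j => ∏ i, (a j - a (j.succAbove i)) with hD
  set R := Lagrange.interpolate Finset.univ a (fun j => r j * D j) with hR
  have hRe (j : Fin (m + 1)) : R.eval (a j) = r j * D j :=
    Lagrange.eval_interpolate_at_node _ ha.injective.injOn (Finset.mem_univ j)
  have hroot (i : Fin m) : ∃ z, (a i.castSucc < z ∧ z < a i.succ) ∧ R.eval z = 0 := by
    refine exists_root_of_eval_mul_neg (ha Fin.castSucc_lt_succ) ?_
    rw [hRe, hRe, mul_mul_mul_comm]
    exact mul_neg_of_pos_of_neg (mul_pos (hr _) (hr _)) (prod_sub_succAbove_mul_neg ha i)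
  choose x hx hx0 using hroot
  have hxI : Interlaces a x := hx
  have hlt := hxI.zero_lt ha
  have hne : ∏ i, (a 0 - x i) ≠ 0 :=
    Finset.prod_ne_zero_iff.2 fun i _ => (sub_neg.2 (hlt i)).ne
  set t := r 0 * D 0 / ∏ i, (a 0 - x i) with ht
  have hpoly : Polynomial.C t * Lagrange.nodal Finset.univ x = R := by
    refine Polynomial.eq_of_degrees_lt_of_eval_index_eq Finset.univ
      (v := (Fin.cons (a 0) x : Fin (m + 1) → ℝ)) ?_ (degree_C_mul_nodal_lt t x)
      (Lagrange.degree_interpolate_lt _ ha.injective.injOn) fun k _ => ?_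
    · refine (Fin.cons_injective_iff.2 ⟨?_, (hxI.strictMono ha).injective⟩).injOn
      rintro ⟨i, hi⟩
      exact (hlt i).ne' hi
    · refine Fin.cases ?_ (fun i => ?_) k
      · rw [Fin.cons_zero, hRe, Polynomial.eval_mul, Polynomial.eval_C, Lagrange.eval_nodal, ht,
          div_mul_cancel₀ _ hne]
      · rw [Fin.cons_succ, hx0, Polynomial.eval_mul,
          Lagrange.eval_nodal_at_node (Finset.mem_univ i), mul_zero]
  have hmap : residueMap a (Fin.cons t x : Fin (m + 1) → ℝ) = r := by
    funext j
    refine mul_right_cancel₀ (prod_sub_succAbove_ne_zero ha j) ?_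
    rw [residueMap_mul_prod ha]
    simp only [Fin.cons_zero, Fin.cons_succ]
    rw [hpoly, hRe]
  refine ⟨Fin.cons t x, ⟨?_, by simpa using hxI⟩, hmap⟩
  have h0 := hr 0
  rw [← hmap, residueMap] at h0
  refine (pos_iff_pos_of_mul_pos h0).2 (Finset.prod_pos fun i _ => ?_)
  simpa using sub_div_sub_succAbove_pos ha hxI 0 i

lemma residueMap_image {m : ℕ} {a : Fin (m + 1) → ℝ} (ha : StrictMono a) :
    residueMap a '' scaledInterlacing a = Set.univ.pi fun _ => Set.Ioi 0 := by
  ext r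
  constructor
  · rintro ⟨p, hp, rfl⟩ j -
    exact residueMap_pos ha hp j
  · intro hr
    obtain ⟨p, hp, h⟩ := exists_residueMap_eq ha fun j => hr j (Set.mem_univ j)
    exact ⟨p, hp, h⟩

/-- The Jacobian matrix of `residueMap`. -/
noncomputable def residueJacobian {m : ℕ} (a p : Fin (m + 1) → ℝ) :
    Matrix (Fin (m + 1)) (Fin (m + 1)) ℝ :=
  Matrix.of fun j k => (∏ i, (a j - a (j.succAbove i)))⁻¹ *
    (Matrix.of fun j k => (Fin.cons 1 (fun _ => -p 0) : Fin (m + 1) → ℝ) k *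
      nodalMatrix a (fun i => p i.succ) j k) j k

lemma hasFDerivAt_residueMap {m : ℕ} (a p : Fin (m + 1) → ℝ) :
    HasFDerivAt (residueMap a)
      (LinearMap.toContinuousLinearMap (Matrix.toLin' (residueJacobian a p))) p := by
  rw [hasFDerivAt_pi']
  intro j
  have h0 : HasFDerivAt (fun q : Fin (m + 1) → ℝ => q 0)
    (ContinuousLinearMap.proj (R := ℝ) (φ := fun _ : Fin (m + 1) => ℝ) 0) p := hasFDerivAt_apply 0 p
  have hi (i : Fin m) : HasFDerivAt (fun q : Fin (m + 1) → ℝ => a j - q i.succ)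
      (-ContinuousLinearMap.proj (R := ℝ) (φ := fun _ : Fin (m + 1) => ℝ) i.succ) p :=
    (hasFDerivAt_apply i.succ p).const_sub (a j)
  have hprod := (h0.mul (HasFDerivAt.finsetProd (u := Finset.univ) fun i _ => hi i)).const_mul
    (∏ i, (a j - a (j.succAbove i)))⁻¹
  have heq : (fun q : Fin (m + 1) → ℝ => residueMap a q j) = fun q =>
      (∏ i, (a j - a (j.succAbove i)))⁻¹ * (q 0 * ∏ i : Fin m, (a j - q i.succ)) := by
    funext q
    rw [residueMap, Finset.prod_div_distrib]
    ring
  rw [heq]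
  refine hprod.congr_fderiv ?_
  ext v
  simp only [residueJacobian, nodalMatrix, smul_apply, add_apply, sum_apply, neg_apply,
    ContinuousLinearMap.proj_apply, ContinuousLinearMap.comp_apply, smul_eq_mul,
    LinearMap.coe_toContinuousLinearMap', Matrix.toLin'_apply, Matrix.mulVec, dotProduct,
    Matrix.of_apply, Fin.sum_univ_succ, Fin.cons_zero, Fin.cons_succ]
  rw [mul_add, add_comm, Finset.mul_sum, Finset.mul_sum]
  congr 1
  · ring
  · exact Finset.sum_congr rfl fun i _ => by ring

lemma prod_abs_sub_succAbove {m : ℕ} {a : Fin (m + 1) → ℝ} (ha : StrictMono a) :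
    ∏ j, ∏ i, |a j - a (j.succAbove i)| = vdm a ^ 2 := by
  rw [← prod_erase_abs_sub ha]
  exact Finset.prod_congr rfl fun j _ => prod_succAbove_eq_prod_erase j fun l => |a j - a l|

lemma abs_det_residueJacobian {m : ℕ} {a p : Fin (m + 1) → ℝ} (ha : StrictMono a)
    (hp : p ∈ scaledInterlacing a) :
    |(residueJacobian a p).det| =
      (vdm a ^ 2)⁻¹ * (p 0 ^ m * (vdm a * vdm fun i : Fin m => p i.succ)) := by
  rw [residueJacobian, Matrix.det_mul_column, Matrix.det_mul_row, abs_mul, abs_mul,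
    abs_det_nodalMatrix ha hp.2, ← prod_abs_sub_succAbove ha]
  simp [Fin.prod_univ_succ, Finset.abs_prod, abs_of_pos hp.1]

lemma prod_residueMap {m : ℕ} {a p : Fin (m + 1) → ℝ} (ha : StrictMono a)
    (hp : p ∈ scaledInterlacing a) :
    ∏ j, residueMap a p j =
      p 0 ^ (m + 1) * (∏ i : Fin m, ∏ j, |a j - p i.succ|) / vdm a ^ 2 := by
  have h (j : Fin (m + 1)) : residueMap a p j =
      p 0 * ((∏ i : Fin m, |a j - p i.succ|) / ∏ i, |a j - a (j.succAbove i)|) := by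
    rw [← abs_of_pos (residueMap_pos ha hp j), residueMap, abs_mul, abs_of_pos hp.1,
      Finset.abs_prod, ← Finset.prod_div_distrib]
    simp_rw [abs_div]
  simp_rw [h]
  rw [Finset.prod_mul_distrib, Finset.prod_div_distrib, prod_abs_sub_succAbove ha,
    Finset.prod_comm, mul_div_assoc]
  simp

lemma dixon_integrand_eq {m : ℕ} {θ : ℝ} {a p : Fin (m + 1) → ℝ} (ha : StrictMono a)
    (hp : p ∈ scaledInterlacing a) :
    |(residueJacobian a p).det| *
        ∏ j, (Real.exp (-residueMap a p j) * residueMap a p j ^ (θ - 1)) =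
      Real.exp (-p 0) * p 0 ^ ((m + 1) * θ - 1) *
        (vdm a ^ (1 - 2 * θ) * ((vdm fun i : Fin m => p i.succ) *
          ∏ i : Fin m, ∏ j, |a j - p i.succ| ^ (θ - 1))) := by
  have hA := vdm_pos ha
  have hT := hp.1
  have hK : 0 ≤ ∏ i : Fin m, ∏ j, |a j - p i.succ| :=
    Finset.prod_nonneg fun _ _ => Finset.prod_nonneg fun _ _ => abs_nonneg _
  rw [Finset.prod_mul_distrib, ← Real.exp_sum, Finset.sum_neg_distrib, sum_residueMap ha,
    Real.finsetProd_rpow _ _ fun j _ => (residueMap_pos ha hp j).le, prod_residueMap ha hp,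
    abs_det_residueJacobian ha hp, Real.div_rpow (mul_nonneg (pow_nonneg hT.le _) hK) (sq_nonneg _),
    Real.mul_rpow (pow_nonneg hT.le _) hK]
  simp_rw [Real.finsetProd_rpow Finset.univ _ fun j _ => abs_nonneg _]
  rw [Real.finsetProd_rpow Finset.univ _ fun i _ => Finset.prod_nonneg fun j _ => abs_nonneg _]
  have h1 : p 0 ^ m * (p 0 ^ (m + 1)) ^ (θ - 1) = p 0 ^ ((m + 1) * θ - 1) := by
    rw [← Real.rpow_natCast, ← Real.rpow_natCast, ← Real.rpow_mul hT.le, ← Real.rpow_add hT]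
    congr 1
    push_cast
    ring
  have h2 : (vdm a ^ 2)⁻¹ * vdm a / (vdm a ^ 2) ^ (θ - 1) = vdm a ^ (1 - 2 * θ) := by
    rw [← Real.rpow_natCast, ← Real.rpow_mul hA.le, ← Real.rpow_neg hA.le]
    nth_rewrite 2 [← Real.rpow_one (vdm a)]
    rw [← Real.rpow_add hA, ← Real.rpow_sub hA]
    congr 1
    push_cast
    ring
  rw [← h1, ← h2]
  ring

lemma lintegral_pi_succ {m : ℕ} (μ : Measure ℝ) [SigmaFinite μ] {F : (Fin (m + 1) → ℝ) → ENNReal}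
    (hF : Measurable F) :
    ∫⁻ p, F p ∂Measure.pi (fun _ : Fin (m + 1) => μ) =
      ∫⁻ t, ∫⁻ x, F (Fin.cons t x) ∂Measure.pi (fun _ : Fin m => μ) ∂μ := by
  have h := (measurePreserving_piFinSuccAbove (fun _ : Fin (m + 1) => μ) 0).symm
  have hcons (t : ℝ) (x : Fin m → ℝ) :
      (MeasurableEquiv.piFinSuccAbove (fun _ : Fin (m + 1) => ℝ) 0).symm (t, x) = Fin.cons t x :=
    Fin.insertNth_zero' t x
  simp_rw [← hcons]
  rw [← h.lintegral_comp hF]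
  exact lintegral_prod (μ := μ) (ν := Measure.pi fun _ : Fin m => μ) _
    (hF.comp h.measurable).aemeasurable

lemma lintegral_pi_prod_eq_pow (μ : Measure ℝ) [SigmaFinite μ] {f : ℝ → ENNReal}
    (hf : Measurable f) (m : ℕ) :
    ∫⁻ p, ∏ j, f (p j) ∂Measure.pi (fun _ : Fin m => μ) = (∫⁻ t, f t ∂μ) ^ m := by
  induction m with
  | zero => simp
  | succ m ih =>
    rw [lintegral_pi_succ μ (by fun_prop)]
    simp_rw [Fin.prod_univ_succ, Fin.cons_zero, Fin.cons_succ]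
    have (t : ℝ) := lintegral_const_mul (μ := Measure.pi (fun _ : Fin m => μ)) (f t)
      (f := fun x => ∏ j, f (x j)) (by fun_prop)
    simp_rw [this, ih]
    rw [lintegral_mul_const _ hf, pow_succ']

lemma lintegral_Gamma {s : ℝ} (hs : 0 < s) :
    ∫⁻ t in Set.Ioi 0, ENNReal.ofReal (Real.exp (-t) * t ^ (s - 1)) =
      ENNReal.ofReal (Real.Gamma s) := by
  rw [Real.Gamma_eq_integral hs, ofReal_integral_eq_lintegral_ofReal
    (Real.GammaIntegral_convergent hs)]
  filter_upwards [ae_restrict_mem measurableSet_Ioi] with t ht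
  exact mul_nonneg (Real.exp_nonneg _) (Real.rpow_nonneg (le_of_lt ht) _)

lemma measurable_vdm {n : ℕ} : Measurable (vdm : (Fin n → ℝ) → ℝ) := by
  unfold vdm
  fun_prop

lemma measurableSet_interlaces {m : ℕ} :
    MeasurableSet {q : (Fin (m + 1) → ℝ) × (Fin m → ℝ) | Interlaces q.1 q.2} := by
  have h : {q : (Fin (m + 1) → ℝ) × (Fin m → ℝ) | Interlaces q.1 q.2} =
      ⋂ i : Fin m, {q | q.1 i.castSucc < q.2 i} ∩ {q | q.2 i < q.1 i.succ} := by
    ext q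
    simp [Interlaces]
  rw [h]
  exact MeasurableSet.iInter fun i => (measurableSet_lt (by fun_prop) (by fun_prop)).inter
    (measurableSet_lt (by fun_prop) (by fun_prop))

lemma measurableSet_interlaces_right {m : ℕ} (a : Fin (m + 1) → ℝ) :
    MeasurableSet {x | Interlaces a x} :=
  measurable_prodMk_left (x := a) measurableSet_interlaces

/-- The Dixon–Anderson integral. -/
lemma dixon_anderson {m : ℕ} {θ : ℝ} (hθ : 0 < θ) {a : Fin (m + 1) → ℝ} (ha : StrictMono a) :
    ENNReal.ofReal (Real.Gamma ((m + 1) * θ)) *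
      ∫⁻ x in {x | Interlaces a x}, ENNReal.ofReal
        (vdm a ^ (1 - 2 * θ) * (vdm x * ∏ i, ∏ j, |a j - x i| ^ (θ - 1))) =
      ENNReal.ofReal (Real.Gamma θ) ^ (m + 1) := by
  have hI := measurableSet_interlaces_right a
  have hS : MeasurableSet (scaledInterlacing a) :=
    (measurableSet_lt measurable_const (measurable_pi_apply 0)).inter
      ((by fun_prop : Measurable fun (p : Fin (m + 1) → ℝ) (i : Fin m) => p i.succ) hI)
  have hv := measurable_vdm (n := m)
  set f : ℝ → ENNReal := fun t => ENNReal.ofReal (Real.exp (-t) * t ^ (θ - 1)) with hf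
  set g : (Fin m → ℝ) → ENNReal := fun x => ENNReal.ofReal
        (vdm a ^ (1 - 2 * θ) * (vdm x * ∏ i, ∏ j, |a j - x i| ^ (θ - 1))) with hg
  have hgm : Measurable g := by fun_prop
  set e : ℝ → ENNReal := fun t => ENNReal.ofReal (Real.exp (-t) * t ^ ((m + 1) * θ - 1)) with he
  have hem : Measurable e := by fun_prop
  have hcv := lintegral_image_eq_lintegral_abs_det_fderiv_mul volume hS
    (fun p _ => (hasFDerivAt_residueMap a p).hasFDerivWithinAt) (residueMap_injOn ha)
    (fun r => ∏ j, f (r j))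
  rw [residueMap_image ha, volume_pi, Measure.restrict_pi_pi,
    lintegral_pi_prod_eq_pow _ (by fun_prop), lintegral_Gamma hθ] at hcv
  rw [hcv, ← lintegral_Gamma (by positivity : 0 < ((m : ℝ) + 1) * θ)]
  have hcongr : ∫⁻ p in scaledInterlacing a, ENNReal.ofReal
        |(LinearMap.toContinuousLinearMap (Matrix.toLin' (residueJacobian a p))).det| *
          ∏ j, f (residueMap a p j) ∂(Measure.pi fun _ => volume) =
      ∫⁻ p in scaledInterlacing a, e (p 0) * g (fun i => p i.succ)
        ∂(Measure.pi fun _ => volume) := by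
    refine setLIntegral_congr_fun hS fun p hp => ?_
    have hr := residueMap_pos ha hp
    simp only [hf, he, hg]
    rw [← ENNReal.ofReal_prod_of_nonneg fun j _ => mul_nonneg (Real.exp_nonneg _)
        (Real.rpow_nonneg (hr j).le _), ← ENNReal.ofReal_mul (abs_nonneg _),
      ← ENNReal.ofReal_mul (mul_nonneg (Real.exp_nonneg _) (Real.rpow_nonneg hp.1.le _)),
      ← dixon_integrand_eq ha hp]
    congr 3
    simp [ContinuousLinearMap.det]
  rw [hcongr, ← lintegral_indicator hS, lintegral_pi_succ _
    (Measurable.indicator (by fun_prop) hS)]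
  have hsplit (t : ℝ) (x : Fin m → ℝ) :
      (scaledInterlacing a).indicator (fun p => e (p 0) * g fun i => p i.succ) (Fin.cons t x) =
        (Set.Ioi 0).indicator e t * {x | Interlaces a x}.indicator g x := by
    by_cases ht : 0 < t <;> by_cases hx : Interlaces a x <;>
      simp [Set.indicator, scaledInterlacing, ht, hx]
  simp_rw [hsplit]
  simp_rw [lintegral_const_mul _ (hgm.indicator hI)]
  rw [lintegral_mul_const _ (hem.indicator measurableSet_Ioi), lintegral_indicator hI,
    lintegral_indicator measurableSet_Ioi, volume_pi]

/-- One level of the θ-Gibbs density. -/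
noncomputable def gibbsFactor (θ : ℝ) (k : ℕ) (a : Fin (k + 2) → ℝ) (x : Fin (k + 1) → ℝ) : ℝ :=
  Real.Gamma ((k + 2) * θ) / Real.Gamma θ ^ (k + 2) * vdm x *
    (∏ i, ∏ j, |a j - x i| ^ (θ - 1)) * ∏ j, ∏ i ∈ Finset.Iio j, (a j - a i) ^ (1 - 2 * θ)

/-- One level of the θ-Gibbs density, extended by zero off the interlacing region. -/
noncomputable def gibbsKernel (θ : ℝ) (k : ℕ) (a : Fin (k + 2) → ℝ) (x : Fin (k + 1) → ℝ) :
    ENNReal :=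
  {q : (Fin (k + 2) → ℝ) × (Fin (k + 1) → ℝ) | Interlaces q.1 q.2}.indicator
    (fun q => ENNReal.ofReal (gibbsFactor θ k q.1 q.2)) (a, x)

lemma measurable_gibbsFactor (θ : ℝ) (k : ℕ) :
    Measurable fun q : (Fin (k + 2) → ℝ) × (Fin (k + 1) → ℝ) => gibbsFactor θ k q.1 q.2 := by
  have := measurable_vdm (n := k + 1)
  unfold gibbsFactor
  fun_prop

lemma measurable_gibbsKernel (θ : ℝ) (k : ℕ) :
    Measurable fun q : (Fin (k + 2) → ℝ) × (Fin (k + 1) → ℝ) => gibbsKernel θ k q.1 q.2 :=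
  (measurable_gibbsFactor θ k).ennreal_ofReal.indicator measurableSet_interlaces

lemma prod_sub_rpow {n : ℕ} {a : Fin n → ℝ} (ha : StrictMono a) (s : ℝ) :
    ∏ j, ∏ i ∈ Finset.Iio j, (a j - a i) ^ s = vdm a ^ s := by
  have h (j : Fin n) : ∀ i ∈ Finset.Iio j, 0 ≤ a j - a i := fun i hi =>
    (sub_pos.2 (ha (Finset.mem_Iio.1 hi))).le
  rw [vdm, ← Real.finsetProd_rpow _ _ fun j _ => Finset.prod_nonneg (h j)]
  exact Finset.prod_congr rfl fun j _ => Real.finsetProd_rpow _ _ (h j) s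

lemma gibbsFactor_eq (θ : ℝ) {k : ℕ} {a : Fin (k + 2) → ℝ} (ha : StrictMono a)
    (x : Fin (k + 1) → ℝ) :
    gibbsFactor θ k a x = Real.Gamma ((k + 2) * θ) / Real.Gamma θ ^ (k + 2) *
      (vdm a ^ (1 - 2 * θ) * (vdm x * ∏ i, ∏ j, |a j - x i| ^ (θ - 1))) := by
  rw [gibbsFactor, prod_sub_rpow ha]
  ring

lemma gibbsFactor_nonneg {θ : ℝ} (hθ : 0 < θ) {k : ℕ} {a : Fin (k + 2) → ℝ} (ha : StrictMono a)
    {x : Fin (k + 1) → ℝ} (hx : StrictMono x) : 0 ≤ gibbsFactor θ k a x := by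
  have h1 := vdm_pos ha
  have h2 := vdm_pos hx
  have h3 := Real.Gamma_pos_of_pos hθ
  have h4 := Real.Gamma_pos_of_pos (by positivity : 0 < ((k : ℝ) + 2) * θ)
  rw [gibbsFactor_eq θ ha]
  positivity

lemma lintegral_gibbsKernel {θ : ℝ} (hθ : 0 < θ) {k : ℕ} {a : Fin (k + 2) → ℝ}
    (ha : StrictMono a) : ∫⁻ x, gibbsKernel θ k a x = 1 := by
  have h3 := Real.Gamma_pos_of_pos hθ
  have h4 := Real.Gamma_pos_of_pos (by positivity : 0 < ((k : ℝ) + 2) * θ)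
  have hI := measurableSet_interlaces_right a
  have hv := measurable_vdm (n := k + 1)
  have h : ∫⁻ x, gibbsKernel θ k a x = ∫⁻ x in {x | Interlaces a x},
      ENNReal.ofReal (Real.Gamma ((k + 2) * θ) / Real.Gamma θ ^ (k + 2)) * ENNReal.ofReal
        (vdm a ^ (1 - 2 * θ) * (vdm x * ∏ i, ∏ j, |a j - x i| ^ (θ - 1))) := by
    rw [← lintegral_indicator hI]
    refine lintegral_congr fun x => ?_
    by_cases hx : Interlaces a x
    · simp only [gibbsKernel, Set.indicator, Set.mem_ofPred_eq, hx, if_true]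
      rw [gibbsFactor_eq θ ha, ENNReal.ofReal_mul (by positivity)]
    · simp [gibbsKernel, Set.indicator, hx]
  have hd := dixon_anderson hθ ha
  rw [h, lintegral_const_mul _ (by fun_prop), ENNReal.ofReal_div_of_pos (by positivity),
    ENNReal.mul_div_right_comm.symm, ENNReal.ofReal_pow h3.le]
  rw [show ((k + 1 : ℕ) : ℝ) + 1 = k + 2 by push_cast; ring] at hd
  rw [hd]
  exact ENNReal.div_self (pow_ne_zero _ (ENNReal.ofReal_pos.2 h3).ne')
    (ENNReal.pow_ne_top ENNReal.ofReal_ne_top)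

lemma glueGT_last {n : ℕ} (y : ∀ k : Fin n, (Fin (k.1 + 1) → ℝ)) (top : Fin (n + 1) → ℝ) :
    glueGT y top (Fin.last n) = top := by
  funext i
  simp [glueGT]

lemma glueGT_castSucc {n : ℕ} (y : ∀ k : Fin n, (Fin (k.1 + 1) → ℝ)) (top : Fin (n + 1) → ℝ)
    (k : Fin n) : glueGT y top k.castSucc = y k := by
  funext i
  simp [glueGT]

lemma measurable_glueGT {n : ℕ} : Measurable
    fun q : (∀ k : Fin n, (Fin (k.1 + 1) → ℝ)) × (Fin (n + 1) → ℝ) => glueGT q.1 q.2 := by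
  refine measurable_pi_iff.2 fun k => measurable_pi_iff.2 fun i => ?_
  unfold glueGT
  split_ifs <;> fun_prop

lemma measurePreserving_glueGT (n : ℕ) : MeasurePreserving
    fun q : (∀ k : Fin n, (Fin (k.1 + 1) → ℝ)) × (Fin (n + 1) → ℝ) => glueGT q.1 q.2 := by
  refine ⟨measurable_glueGT, (Measure.pi_eq fun s hs => ?_).symm⟩
  have h : (fun q : (∀ k : Fin n, (Fin (k.1 + 1) → ℝ)) × (Fin (n + 1) → ℝ) => glueGT q.1 q.2) ⁻¹'
      Set.univ.pi s = (Set.univ.pi fun k : Fin n => s k.castSucc) ×ˢ s (Fin.last n) := by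
    ext q
    simp only [Set.mem_preimage, Set.mem_univ_pi, Fin.forall_fin_succ', Set.mem_prod,
      glueGT_last, glueGT_castSucc]
  rw [Measure.map_apply measurable_glueGT (MeasurableSet.univ_pi hs), h, Measure.volume_eq_prod,
    Measure.prod_prod, volume_pi, Measure.pi_pi, Fin.prod_univ_castSucc]

lemma lintegral_glueGT {n : ℕ} {F : (∀ k : Fin (n + 1), (Fin (k.1 + 1) → ℝ)) → ENNReal}
    (hF : Measurable F) : ∫⁻ y, F y =
      ∫⁻ x : Fin (n + 1) → ℝ, ∫⁻ y : ∀ k : Fin n, (Fin (k.1 + 1) → ℝ), F (glueGT y x) := by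
  rw [← (measurePreserving_glueGT n).map_eq, lintegral_map hF measurable_glueGT,
    Measure.volume_eq_prod]
  exact lintegral_prod_symm' _ (hF.comp measurable_glueGT)

/-- The θ-Gibbs density, extended by zero off the interlacing arrays. -/
noncomputable def gibbsWeight (θ : ℝ) {n : ℕ} (y : ∀ k : Fin n, (Fin (k.1 + 1) → ℝ))
    (top : Fin (n + 1) → ℝ) : ENNReal :=
  ∏ k : Fin n, gibbsKernel θ k (glueGT y top k.succ) (glueGT y top k.castSucc)

lemma measurable_glueGT_left {n : ℕ} (top : Fin (n + 1) → ℝ) :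
    Measurable fun y : ∀ k : Fin n, (Fin (k.1 + 1) → ℝ) => glueGT y top :=
  measurable_glueGT.comp (measurable_id.prodMk measurable_const)

lemma measurable_glueGT_levels {n : ℕ} (top : Fin (n + 1) → ℝ) (k : Fin n) :
    Measurable fun y : ∀ k : Fin n, (Fin (k.1 + 1) → ℝ) =>
      ((glueGT y top k.succ, glueGT y top k.castSucc) :
        (Fin (k.1 + 2) → ℝ) × (Fin (k.1 + 1) → ℝ)) :=
  ((measurable_pi_apply k.succ).comp (measurable_glueGT_left top)).prodMk
    ((measurable_pi_apply k.castSucc).comp (measurable_glueGT_left top))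

lemma measurable_gibbsWeight (θ : ℝ) {n : ℕ} (top : Fin (n + 1) → ℝ) :
    Measurable fun y : ∀ k : Fin n, (Fin (k.1 + 1) → ℝ) => gibbsWeight θ y top :=
  Finset.measurable_fun_prod _ fun k _ =>
    (measurable_gibbsKernel θ k).comp (measurable_glueGT_levels top k)

lemma gibbsWeight_glueGT (θ : ℝ) {n : ℕ} (y : ∀ k : Fin n, (Fin (k.1 + 1) → ℝ))
    (x : Fin (n + 1) → ℝ) (top : Fin (n + 2) → ℝ) :
    gibbsWeight θ (glueGT y x) top = gibbsKernel θ n top x * gibbsWeight θ y x := by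
  rw [gibbsWeight, Fin.prod_univ_castSucc, mul_comm]
  congr 1
  · rw [glueGT_castSucc, glueGT_last]
    exact congrArg (fun a => gibbsKernel θ n a x) (glueGT_last (glueGT y x) top)
  · refine Finset.prod_congr rfl fun k _ => ?_
    rw [glueGT_castSucc]
    exact congrArg (fun a => gibbsKernel θ k a (glueGT y x k.castSucc))
      (glueGT_castSucc (glueGT y x) top k.succ)

lemma lintegral_gibbsWeight {θ : ℝ} (hθ : 0 < θ) (n : ℕ) {top : Fin (n + 1) → ℝ}
    (htop : StrictMono top) : ∫⁻ y, gibbsWeight θ y top = 1 := by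
  induction n with
  | zero => simp [gibbsWeight, volume_pi, Measure.pi_empty_univ]
  | succ n ih =>
    rw [lintegral_glueGT (measurable_gibbsWeight θ top), ← lintegral_gibbsKernel hθ htop]
    refine lintegral_congr fun x => ?_
    simp_rw [gibbsWeight_glueGT]
    rw [lintegral_const_mul _ (measurable_gibbsWeight θ x)]
    by_cases hx : Interlaces top x
    · rw [ih (hx.strictMono htop), mul_one]
    · have : gibbsKernel θ n top x = 0 := Set.indicator_of_notMem hx _
      rw [this, zero_mul]

lemma strictInterlacing_iff {n : ℕ} (Y : ∀ k : Fin (n + 1), (Fin (k.1 + 1) → ℝ)) :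
    StrictInterlacing Y ↔ ∀ k : Fin n, Interlaces (Y k.succ) (Y k.castSucc) := Iff.rfl

lemma StrictInterlacing.strictMono {n : ℕ} {Y : ∀ k : Fin (n + 1), (Fin (k.1 + 1) → ℝ)}
    (hY : StrictInterlacing Y) (hlast : StrictMono (Y (Fin.last n))) (k : Fin (n + 1)) :
    StrictMono (Y k) := by
  induction k using Fin.reverseInduction with
  | last => exact hlast
  | cast k ih => exact ((strictInterlacing_iff Y).1 hY k).strictMono ih

lemma measurableSet_strictInterlacing {n : ℕ} (top : Fin (n + 1) → ℝ) :
    MeasurableSet {y | StrictInterlacing (glueGT y top)} := by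
  have h : {y | StrictInterlacing (glueGT y top)} = ⋂ k : Fin n,
      {y | Interlaces (glueGT y top k.succ) (glueGT y top k.castSucc)} := by
    ext y
    simp [strictInterlacing_iff]
  rw [h]
  exact MeasurableSet.iInter fun k => measurable_glueGT_levels top k measurableSet_interlaces

lemma gibbsWeight_eq_indicator {θ : ℝ} (hθ : 0 < θ) {n : ℕ} {top : Fin (n + 1) → ℝ}
    (htop : StrictMono top) (y : ∀ k : Fin n, (Fin (k.1 + 1) → ℝ)) :
    gibbsWeight θ y top = {y | StrictInterlacing (glueGT y top)}.indicator
      (fun y => ENNReal.ofReal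
        (∏ k : Fin n, gibbsFactor θ k (glueGT y top k.succ) (glueGT y top k.castSucc))) y := by
  by_cases hy : StrictInterlacing (glueGT y top)
  · have hmono := hy.strictMono (by rw [glueGT_last]; exact htop)
    rw [Set.indicator_of_mem hy, ENNReal.ofReal_prod_of_nonneg fun k _ =>
      gibbsFactor_nonneg hθ (hmono k.succ) (hmono k.castSucc)]
    exact Finset.prod_congr rfl fun k _ =>
      Set.indicator_of_mem ((strictInterlacing_iff _).1 hy k) _
  · rw [Set.indicator_of_notMem hy]
    rw [strictInterlacing_iff, not_forall] at hy
    obtain ⟨k, hk⟩ := hy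
    exact Finset.prod_eq_zero (Finset.mem_univ k) (Set.indicator_of_notMem hk _)

lemma measurable_gibbsFactor_levels (θ : ℝ) {n : ℕ} (top : Fin (n + 1) → ℝ) (k : Fin n) :
    Measurable fun y : ∀ k : Fin n, (Fin (k.1 + 1) → ℝ) =>
      gibbsFactor θ k (glueGT y top k.succ) (glueGT y top k.castSucc) := by
  have h := (measurable_gibbsFactor θ k).comp (measurable_glueGT_levels top k)
  simp only [Function.comp_def] at h
  exact h

lemma integral_gibbsFactor {θ : ℝ} (hθ : 0 < θ) {n : ℕ} {top : Fin (n + 1) → ℝ}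
    (htop : StrictMono top) :
    ∫ y in {y : ∀ k : Fin n, (Fin (k.1 + 1) → ℝ) | StrictInterlacing (glueGT y top)},
      ∏ k : Fin n, gibbsFactor θ k (glueGT y top k.succ) (glueGT y top k.castSucc) = 1 := by
  have hS := measurableSet_strictInterlacing top
  have hF : Measurable fun y => ∏ k : Fin n,
      gibbsFactor θ k (glueGT y top k.succ) (glueGT y top k.castSucc) :=
    Finset.measurable_fun_prod _ fun k _ => measurable_gibbsFactor_levels θ top k
  rw [integral_eq_lintegral_of_nonneg_ae ?_ hF.aestronglyMeasurable, ← lintegral_indicator hS]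
  · simp_rw [← gibbsWeight_eq_indicator hθ htop]
    rw [lintegral_gibbsWeight hθ n htop, ENNReal.toReal_one]
  · filter_upwards [ae_restrict_mem hS] with y hy
    have hmono := StrictInterlacing.strictMono hy (by rw [glueGT_last]; exact htop)
    exact Finset.prod_nonneg fun k _ =>
      gibbsFactor_nonneg hθ (hmono k.succ) (hmono k.castSucc)

/-- **The θ-Gibbs conditional density integrates to one.** For a fixed top row
`top` in the open Weyl chamber (here `N = n+1 ≥ 2`), the integral over all strictly
interlacing arrays below it of
`∏_{k=2}^{N} (Γ(kθ)/Γ(θ)^k) ∏_{1≤i<m≤k−1}(y^{k−1}_m−y^{k−1}_i)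
  ∏_{i=1}^{k−1}∏_{j=1}^{k}|y^k_j−y^{k−1}_i|^{θ−1} ∏_{1≤j<n'≤k}(y^k_{n'}−y^k_j)^{1−2θ}`
equals `1`. -/
theorem theta_gibbs_density_integrates_to_one (n : ℕ) (hn : 1 ≤ n) (θ : ℝ) (hθ : 0 < θ)
    (top : Fin (n + 1) → ℝ) (htop : StrictMono top) :
    (∫ y : (∀ k : Fin n, (Fin (k.1 + 1) → ℝ)) in {y | StrictInterlacing (glueGT y top)},
      ∏ k : Fin n,
        (Real.Gamma (((k : ℕ) + 2) * θ) / Real.Gamma θ ^ ((k : ℕ) + 2) *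
          (∏ m : Fin (k.1 + 1), ∏ i ∈ Finset.Iio m,
            (glueGT y top k.castSucc m - glueGT y top k.castSucc i)) *
          (∏ i : Fin (k.1 + 1), ∏ j : Fin (k.1 + 2),
            |glueGT y top k.succ j - glueGT y top k.castSucc i| ^ (θ - 1)) *
          ∏ j : Fin (k.1 + 2), ∏ i ∈ Finset.Iio j,
            (glueGT y top k.succ j - glueGT y top k.succ i) ^ (1 - 2 * θ)))
    = 1 := by
  have key := integral_gibbsFactor hθ htop
  unfold gibbsFactor vdm at key
  exact key
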